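/- Let N and k be positive integers, and let p, q : ℝ → ℂ be functions continuous at 0 with p(0), q(0) not lying on the closed negative real axis (−∞,0], with p(ν) and q(ν) nonzero for all ν in some neighborhood of 0, and satisfying p(ν)^N − ν·Log p(ν) = q(ν)^N − ν·Log q(ν) for all ν in that neighborhood, where Log is the principal complex logarithm. Then the limit as ν → 0 (ν ≠ 0) of (p(ν)^{kN} − q(ν)^{kN})/ν exists and equals k·(p(0)^{(k−1)N}·Log p(0) − q(0)^{(k−1)N}·Log q(0)). -/

import Mathlib

open Filter

/-- If `p(ν), q(ν)` are continuous at `0`, nonvanishing and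
satisfying `p(ν)^N − ν·Log p(ν) = q(ν)^N − ν·Log q(ν)` near `0`, with
`p(0), q(0)` off the closed negative real axis, then
`(p(ν)^{kN} − q(ν)^{kN})/ν → k·(p(0)^{(k−1)N}·Log p(0) − q(0)^{(k−1)N}·Log q(0))`
as `ν → 0`, `ν ≠ 0`. -/
theorem stmt_3 (N k : ℕ) (hN : 0 < N) (hk : 0 < k)
    (p q : ℝ → ℂ) (hp : ContinuousAt p 0) (hq : ContinuousAt q 0)
    (hp0 : p 0 ∈ Complex.slitPlane) (hq0 : q 0 ∈ Complex.slitPlane)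
    (hred : ∀ᶠ ν in nhds (0 : ℝ), p ν ≠ 0 ∧ q ν ≠ 0 ∧
      p ν ^ N - (ν : ℂ) * Complex.log (p ν)
        = q ν ^ N - (ν : ℂ) * Complex.log (q ν)) :
    Tendsto (fun ν : ℝ => (p ν ^ (k * N) - q ν ^ (k * N)) / (ν : ℂ))
      (nhdsWithin (0 : ℝ) {0}ᶜ)
      (nhds ((k : ℂ) * (p 0 ^ ((k - 1) * N) * Complex.log (p 0)
        - q 0 ^ ((k - 1) * N) * Complex.log (q 0)))) := by
  have h0 : p 0 ^ N = q 0 ^ N := by simpa using hred.self_of_nhds.2.2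
  have hlim : ContinuousAt (fun ν : ℝ =>
      (∑ i ∈ Finset.range k, (p ν ^ N) ^ i * (q ν ^ N) ^ (k - 1 - i)) *
        (Complex.log (p ν) - Complex.log (q ν))) 0 := by
    refine ContinuousAt.mul ?_ ((hp.clog hp0).sub (hq.clog hq0))
    exact tendsto_finsetSum _ fun i _ => ((hp.pow N).pow i).mul ((hq.pow N).pow (k - 1 - i))
  have hval : (k : ℂ) * (p 0 ^ ((k - 1) * N) * Complex.log (p 0)
        - q 0 ^ ((k - 1) * N) * Complex.log (q 0)) =
      (∑ i ∈ Finset.range k, (p 0 ^ N) ^ i * (q 0 ^ N) ^ (k - 1 - i)) *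
        (Complex.log (p 0) - Complex.log (q 0)) := by
    rw [mul_comm (k - 1) N, pow_mul, pow_mul, h0, geom_sum₂_self]
    ring
  rw [hval]
  refine (hlim.tendsto.mono_left nhdsWithin_le_nhds).congr' ?_
  filter_upwards [hred.filter_mono nhdsWithin_le_nhds, self_mem_nhdsWithin] with ν hν hne
  have hν0 : (ν : ℂ) ≠ 0 := Complex.ofReal_ne_zero.mpr hne
  have hdiff : p ν ^ N - q ν ^ N = ν * (Complex.log (p ν) - Complex.log (q ν)) := by
    linear_combination hν.2.2
  rw [mul_comm k N, pow_mul, pow_mul, ← geom_sum₂_mul, hdiff, eq_div_iff hν0]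
  ring
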